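/- Let n ≥ 1 and let Λ be a lattice of full rank in ℝ^n. Assume B ≥ 8 n^{n/2} · ν(Λ) and B₁ ≥ 8 n² (n+1) B. Let y₁,…,y_n ∈ Λ ∩ [0,B)^n be vectors that span ℝ^n as a real vector space. Let X₁ = (Λ ∩ [0,B₁)^n)^{n+1} and Z = {(z₁,…,z_{n+1}) ∈ X₁ : the ℤ-span of y₁,…,y_n,z₁,…,z_{n+1} equals Λ}. Then |Z| ≥ (∏_{i=2}^∞ ζ(i)^{-1} − 1/4) · |X₁| ≥ 0.184 · |X₁|. -/

import Mathlib

/-- The real Riemann zeta value `ζ(i) = ∑_{k=1}^∞ k^{-i}`. -/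
noncomputable def zetaR (i : ℕ) : ℝ := ∑' k : ℕ, 1 / (k + 1 : ℝ) ^ i

/-- The covering radius of a lattice: the supremum over `x` of the distance from `x`
to the nearest lattice point. -/
noncomputable def covRad {n : ℕ} (Λ : Submodule ℤ (EuclideanSpace ℝ (Fin n))) : ℝ :=
  ⨆ x : EuclideanSpace ℝ (Fin n), Metric.infDist x (Λ : Set (EuclideanSpace ℝ (Fin n)))

/-- The half-open cube `[0, B)^n`. -/
def cube (n : ℕ) (B : ℝ) : Set (EuclideanSpace ℝ (Fin n)) :=
  {x | ∀ i, 0 ≤ x i ∧ x i < B}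

section Zeta

lemma summable_one_div_succ_pow {i : ℕ} (hi : 2 ≤ i) :
    Summable fun k : ℕ => 1 / (k + 1 : ℝ) ^ i := by
  have h := (summable_nat_add_iff 1).2 (Real.summable_one_div_nat_pow.2 (show 1 < i by omega))
  simpa using h

lemma one_le_zetaR {i : ℕ} (hi : 2 ≤ i) : 1 ≤ zetaR i := by
  have h := (summable_one_div_succ_pow hi).le_tsum 0 fun k _ => by positivity
  simpa [zetaR] using h

/-- An upper bound for `ζ(i)` obtained by comparing the tail of the series with the telescoping
series `∑ 1 / (k (k + 1) (k + 2))`. -/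
lemma zetaR_le_sum_add {i K : ℕ} (hi : 3 ≤ i) (hK : 1 ≤ K) :
    zetaR i ≤ ∑ k ∈ Finset.range K, 1 / (k + 1 : ℝ) ^ i +
      1 / ((K : ℝ) ^ (i - 3) * (2 * K * (K + 1))) := by
  obtain ⟨j, rfl⟩ := Nat.exists_eq_add_of_le' hi
  have hK' : (1 : ℝ) ≤ K := by exact_mod_cast hK
  simp only [Nat.add_sub_cancel]
  have key : ∀ N : ℕ, ∑ k ∈ Finset.range (K + N), 1 / (k + 1 : ℝ) ^ (j + 3) +
      1 / ((K : ℝ) ^ j * (2 * (K + N) * (K + N + 1))) ≤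
      ∑ k ∈ Finset.range K, 1 / (k + 1 : ℝ) ^ (j + 3) +
      1 / ((K : ℝ) ^ j * (2 * K * (K + 1))) := by
    intro N
    induction N with
    | zero => simp
    | succ N ih =>
      refine le_trans ?_ ih
      rw [← add_assoc, Finset.sum_range_succ, add_assoc, add_le_add_iff_left]
      push_cast
      have hm : (1 : ℝ) ≤ K + N := by have : (0 : ℝ) ≤ N := N.cast_nonneg; linarith
      have hKm : (K : ℝ) ≤ K + N + 1 := by have : (0 : ℝ) ≤ N := N.cast_nonneg; linarith
      rw [← add_assoc]
      generalize (K + N : ℝ) = m at hm hKm ⊢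
      have h1 : 1 / (m + 1) ^ (j + 3) ≤ 1 / ((K : ℝ) ^ j * (m * (m + 1) * (m + 2))) := by
        apply one_div_le_one_div_of_le (by positivity)
        rw [pow_add]
        apply mul_le_mul (pow_le_pow_left₀ (by positivity) hKm j) _ (by positivity) (by positivity)
        nlinarith
      have h2 : 1 / ((K : ℝ) ^ j * (m * (m + 1) * (m + 2))) +
          1 / ((K : ℝ) ^ j * (2 * (m + 1) * (m + 1 + 1))) =
          1 / ((K : ℝ) ^ j * (2 * m * (m + 1))) := by
        field_simp
        ring
      linarith
  apply Real.tsum_le_of_sum_range_le (fun k => by positivity)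
  intro N
  calc _ ≤ ∑ k ∈ Finset.range (K + N), 1 / (k + 1 : ℝ) ^ (j + 3) :=
        Finset.sum_le_sum_of_subset_of_nonneg (Finset.range_subset_range.2 (by omega))
          fun _ _ _ => by positivity
    _ ≤ _ := by
        have := key N
        have : 0 ≤ 1 / ((K : ℝ) ^ j * (2 * (K + N) * (K + N + 1))) := by positivity
        linarith

lemma zetaR_le_one_add {i : ℕ} (hi : 3 ≤ i) : zetaR i ≤ 1 + 5 / 3 * (1 / 2) ^ i := by
  refine (zetaR_le_sum_add (K := 2) hi (by norm_num)).trans_eq ?_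
  obtain ⟨j, rfl⟩ := Nat.exists_eq_add_of_le' hi
  simp only [Finset.sum_range_succ, Finset.sum_range_zero, Nat.add_sub_cancel]
  rw [one_div_pow]
  norm_num [pow_add]
  field_simp
  ring

lemma zetaR_two : zetaR 2 = Real.pi ^ 2 / 6 := by
  have h := (hasSum_nat_add_iff' 1).2 hasSum_zeta_two
  simpa [zetaR] using h.tsum_eq

lemma multipliable_inv_zetaR : Multipliable fun i : ℕ => (zetaR (i + 2))⁻¹ := by
  have h : Summable fun i : ℕ => (zetaR (i + 2) - 1 : ℝ) := by
    refine (summable_nat_add_iff 1).1 ?_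
    refine Summable.of_nonneg_of_le (fun i => sub_nonneg.2 (one_le_zetaR (by omega)))
      (fun i => ?_) ((summable_geometric_two.mul_left (5 / 3)))
    have h1 := zetaR_le_one_add (show 3 ≤ i + 1 + 2 by omega)
    have h2 : ((1 : ℝ) / 2) ^ (i + 1 + 2) ≤ (1 / 2) ^ i :=
      pow_le_pow_of_le_one (by norm_num) (by norm_num) (by omega)
    linarith
  have h' : Multipliable fun i : ℕ => (1 + ((zetaR (i + 2))⁻¹ - 1)) := by
    refine multipliable_one_add_of_summable (Summable.of_nonneg_of_le (fun i => norm_nonneg _)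
      (fun i => ?_) h)
    have h1 := one_le_zetaR (show 2 ≤ i + 2 by omega)
    have h2 : 1 - (zetaR (i + 2))⁻¹ ≤ zetaR (i + 2) - 1 := by
      have := inv_pos.2 (lt_of_lt_of_le one_pos h1)
      have := mul_inv_cancel₀ (lt_of_lt_of_le one_pos h1).ne'
      nlinarith
    rw [Real.norm_eq_abs, abs_of_nonpos (by linarith [inv_le_one_of_one_le₀ h1])]
    linarith
  simpa using h'

lemma tprod_inv_zetaR_le_prod (n : ℕ) :
    ∏' i : ℕ, (zetaR (i + 2))⁻¹ ≤ ∏ i ∈ Finset.range n, (zetaR (i + 2))⁻¹ := by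
  refine Antitone.le_of_tendsto (f := fun n => ∏ i ∈ Finset.range n, (zetaR (i + 2))⁻¹)
    (antitone_nat_of_succ_le fun m => ?_) multipliable_inv_zetaR.tendsto_prod_tprod_nat n
  rw [Finset.prod_range_succ]
  refine mul_le_of_le_one_right (Finset.prod_nonneg fun i _ => ?_)
    (inv_le_one_of_one_le₀ (one_le_zetaR (by omega)))
  have := one_le_zetaR (show 2 ≤ i + 2 by omega)
  positivity

lemma prod_inv_zetaR_nine : 0.4356 ≤ ∏ i ∈ Finset.range 8, (zetaR (i + 2))⁻¹ := by
  have h2 : zetaR 2 ≤ 1.64495 := by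
    rw [zetaR_two]
    have := Real.pi_lt_d6
    have := Real.pi_pos
    nlinarith
  have h3 := zetaR_le_sum_add (i := 3) (K := 10) (by norm_num) (by norm_num)
  have h4 := zetaR_le_sum_add (i := 4) (K := 6) (by norm_num) (by norm_num)
  have h5 := zetaR_le_sum_add (i := 5) (K := 5) (by norm_num) (by norm_num)
  have h6 := zetaR_le_sum_add (i := 6) (K := 4) (by norm_num) (by norm_num)
  have h7 := zetaR_le_sum_add (i := 7) (K := 4) (by norm_num) (by norm_num)
  have h8 := zetaR_le_sum_add (i := 8) (K := 3) (by norm_num) (by norm_num)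
  have h9 := zetaR_le_sum_add (i := 9) (K := 3) (by norm_num) (by norm_num)
  replace h3 : zetaR 3 ≤ 1.2021 := h3.trans (by norm_num [Finset.sum_range_succ])
  replace h4 : zetaR 4 ≤ 1.0832 := h4.trans (by norm_num [Finset.sum_range_succ])
  replace h5 : zetaR 5 ≤ 1.0374 := h5.trans (by norm_num [Finset.sum_range_succ])
  replace h6 : zetaR 6 ≤ 1.0177 := h6.trans (by norm_num [Finset.sum_range_succ])
  replace h7 : zetaR 7 ≤ 1.0085 := h7.trans (by norm_num [Finset.sum_range_succ])
  replace h8 : zetaR 8 ≤ 1.0043 := h8.trans (by norm_num [Finset.sum_range_succ])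
  replace h9 : zetaR 9 ≤ 1.0021 := h9.trans (by norm_num [Finset.sum_range_succ])
  have pos : ∀ i, 2 ≤ i → 0 < zetaR i := fun i hi => lt_of_lt_of_le one_pos (one_le_zetaR hi)
  have p2 := pos 2 (by norm_num)
  have p3 := pos 3 (by norm_num)
  have p4 := pos 4 (by norm_num)
  have p5 := pos 5 (by norm_num)
  have p6 := pos 6 (by norm_num)
  have p7 := pos 7 (by norm_num)
  have p8 := pos 8 (by norm_num)
  have p9 := pos 9 (by norm_num)
  rw [Finset.prod_inv_distrib]
  simp only [Finset.prod_range_succ, Finset.prod_range_zero, one_mul, Nat.reduceAdd, zero_add]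
  rw [le_inv_comm₀ (by norm_num) (by positivity)]
  calc _ ≤ (1.64495 : ℝ) * 1.2021 * 1.0832 * 1.0374 * 1.0177 * 1.0085 * 1.0043 * 1.0021 := by
        gcongr
    _ ≤ _ := by norm_num

lemma le_tprod_inv_zetaR : 0.434 ≤ ∏' i : ℕ, (zetaR (i + 2))⁻¹ := by
  have key : ∀ N : ℕ, 0.4356 * (1 - 5 / 3 * ((1 / 2) ^ 9 - (1 / 2) ^ (N + 9))) ≤
      ∏ i ∈ Finset.range (N + 8), (zetaR (i + 2))⁻¹ := by
    intro N
    induction N with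
    | zero => simpa using prod_inv_zetaR_nine
    | succ N ih =>
      rw [show N + 1 + 8 = N + 8 + 1 by ring, Finset.prod_range_succ]
      have h1 := one_le_zetaR (show 2 ≤ N + 8 + 2 by omega)
      have h2 := zetaR_le_one_add (show 3 ≤ N + 8 + 2 by omega)
      have ha : ((1 : ℝ) / 2) ^ (N + 8 + 2) = (1 / 2) ^ (N + 9) / 2 := by ring
      have hb : ((1 : ℝ) / 2) ^ (N + 1 + 9) = (1 / 2) ^ (N + 9) / 2 := by ring
      have ht : ((1 : ℝ) / 2) ^ (N + 9) ≤ (1 / 2) ^ 9 :=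
        pow_le_pow_of_le_one (by norm_num) (by norm_num) (by omega)
      have ht0 : (0 : ℝ) < (1 / 2) ^ (N + 9) := by positivity
      rw [ha] at h2
      rw [hb]
      generalize ((1 : ℝ) / 2) ^ (N + 9) = t at *
      have h3 : 1 - 5 / 3 * (t / 2) ≤ (zetaR (N + 8 + 2))⁻¹ := by
        have hp := inv_pos.2 (lt_of_lt_of_le one_pos h1)
        have := mul_inv_cancel₀ (lt_of_lt_of_le one_pos h1).ne'
        nlinarith [inv_le_one_of_one_le₀ h1]
      norm_num at ht
      calc _ ≤ 0.4356 * (1 - 5 / 3 * ((1 / 2) ^ 9 - t)) * (1 - 5 / 3 * (t / 2)) := by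
            nlinarith
        _ ≤ _ := mul_le_mul ih h3 (by linarith)
            (le_trans (by norm_num; linarith) ih)
  refine ge_of_tendsto multipliable_inv_zetaR.tendsto_prod_tprod_nat ?_
  filter_upwards [Filter.eventually_ge_atTop 8] with N hN
  obtain ⟨M, rfl⟩ := Nat.exists_eq_add_of_le' hN
  refine le_trans ?_ (key M)
  have : (0 : ℝ) < (1 / 2) ^ (M + 9) := by positivity
  norm_num
  linarith

/-- A finite part of the Euler product of `ζ(i)`. -/
lemma inv_zetaR_le_prod_primes {i : ℕ} (hi : 2 ≤ i) (s : Finset ℕ) (hs : ∀ p ∈ s, p.Prime) :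
    (zetaR i)⁻¹ ≤ ∏ p ∈ s, (1 - ((p : ℝ) ^ i)⁻¹) := by
  let f : ℕ →* ℝ :=
    { toFun := fun k => ((k : ℝ) ^ i)⁻¹
      map_one' := by simp
      map_mul' := fun a b => by simp [mul_pow, mul_comm] }
  have hsum : Summable f := Real.summable_nat_pow_inv.2 (by omega)
  have h := EulerProduct.prod_filter_prime_geometric_eq_tsum_factoredNumbers hsum s
  rw [Finset.filter_true_of_mem hs, Finset.prod_inv_distrib] at h
  have hz : zetaR i = ∑' k, f k := by
    rw [hsum.tsum_eq_zero_add]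
    simp [f, zetaR, show i ≠ 0 by omega]
  have hle : (∏ p ∈ s, (1 - f p))⁻¹ ≤ zetaR i := by
    rw [h, hz]
    exact Summable.tsum_subtype_le f _ (fun k => inv_nonneg.2 (by positivity)) hsum
  have hpos : 0 < ∏ p ∈ s, (1 - f p) := by
    refine Finset.prod_pos fun p hp => sub_pos.2 ?_
    have h1 : (1 : ℝ) < (p : ℝ) ^ i :=
      one_lt_pow₀ (by exact_mod_cast (hs p hp).one_lt) (by omega)
    exact inv_lt_one_of_one_lt₀ h1
  exact (inv_le_comm₀ hpos (lt_of_lt_of_le one_pos (one_le_zetaR hi))).1 hle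

end Zeta

section FiniteField

variable {K : Type*} [Field K]

lemma span_range_eq_top_iff_linearIndependent_transpose {k r : ℕ} (z : Fin k → Fin r → K) :
    Submodule.span K (Set.range z) = ⊤ ↔ LinearIndependent K fun j i => z i j := by
  rw [linearIndependent_iff_card_eq_finrank_span, Set.finrank, Fintype.card_fin]
  have h1 := Matrix.rank_eq_finrank_span_row (Matrix.of z)
  have h2 := Matrix.rank_eq_finrank_span_cols (Matrix.of z)
  change _ = Module.finrank K (Submodule.span K (Set.range z)) at h1
  change _ = Module.finrank K (Submodule.span K (Set.range fun j i => z i j)) at h2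
  rw [← h2, h1]
  constructor
  · intro h
    rw [h, finrank_top, Module.finrank_fin_fun]
  · intro h
    exact Submodule.eq_top_of_finrank_eq (by rw [← h, Module.finrank_fin_fun])

variable [Fintype K]

lemma card_spanning_tuples_pi {k r : ℕ} (hr : r ≤ k) :
    Nat.card {z : Fin k → Fin r → K // Submodule.span K (Set.range z) = ⊤} =
      ∏ i : Fin r, (Fintype.card K ^ k - Fintype.card K ^ (i : ℕ)) := by
  have h := card_linearIndependent (K := K) (V := Fin k → K) (k := r) (by simpa using hr)
  rw [Module.finrank_fin_fun] at h
  rw [← h]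
  exact Nat.card_congr ((Equiv.piComm fun _ _ => K).subtypeEquiv
    fun z => span_range_eq_top_iff_linearIndependent_transpose z)

/-- The proportion of spanning `(n + 1)`-tuples in a vector space of dimension at most `n` over a
finite field with `q` elements is at least `∏_{i = 2}^{n + 1} (1 - q⁻ⁱ)`. -/
lemma le_card_spanning_tuples {V : Type*} [AddCommGroup V] [Module K V] [Finite V] {n : ℕ}
    (hn : Module.finrank K V ≤ n) :
    (∏ i ∈ Finset.range n, (1 - ((Fintype.card K : ℝ) ^ (i + 2))⁻¹)) * (Nat.card V : ℝ) ^ (n + 1) ≤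
      Nat.card {z : Fin (n + 1) → V // Submodule.span K (Set.range z) = ⊤} := by
  set r := Module.finrank K V with hr
  have : Module.Finite K V := Module.Finite.of_finite
  let e : V ≃ₗ[K] (Fin r → K) := (Module.finBasis K V).equivFun
  have hcard : Nat.card {z : Fin (n + 1) → V // Submodule.span K (Set.range z) = ⊤} =
      Nat.card {z : Fin (n + 1) → Fin r → K // Submodule.span K (Set.range z) = ⊤} := by
    refine Nat.card_congr ((Equiv.arrowCongr (Equiv.refl _) e.toEquiv).subtypeEquiv fun z => ?_)
    have h : Set.range ((Equiv.refl (Fin (n + 1))).arrowCongr e.toEquiv z) = e '' Set.range z := by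
      rw [← Set.range_comp]; rfl
    rw [h, ← LinearEquiv.coe_coe, Submodule.span_image]
    constructor
    · intro h; rw [h, Submodule.map_top, LinearEquiv.range]
    · intro h
      exact Submodule.map_injective_of_injective e.injective
        (by rw [h, Submodule.map_top, LinearEquiv.range])
  have hV : Nat.card V = Fintype.card K ^ r := by
    rw [Nat.card_congr e.toEquiv]; simp
  rw [hcard, card_spanning_tuples_pi (by omega), hV]
  set q := Fintype.card K
  have hq : (1 : ℝ) < q := by exact_mod_cast Fintype.one_lt_card (α := K)
  have hq0 : (0 : ℝ) < q := by linarith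
  have hfac : ∀ i : ℕ, 0 ≤ 1 - ((q : ℝ) ^ (i + 2))⁻¹ ∧ 1 - ((q : ℝ) ^ (i + 2))⁻¹ ≤ 1 := fun i =>
    ⟨sub_nonneg.2 (inv_le_one_of_one_le₀ (one_le_pow₀ hq.le)), by
      have : 0 ≤ ((q : ℝ) ^ (i + 2))⁻¹ := by positivity
      linarith⟩
  obtain ⟨d, rfl⟩ := Nat.exists_eq_add_of_le hn
  have hcast : ((∏ i : Fin r, (q ^ (r + d + 1) - q ^ (i : ℕ)) : ℕ) : ℝ) =
      (∏ j ∈ Finset.range r, (1 - ((q : ℝ) ^ (d + j + 2))⁻¹)) * ((q : ℝ) ^ r) ^ (r + d + 1) := by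
    rw [← pow_mul, mul_comm r, pow_mul, ← Finset.card_range r, ← Finset.prod_const,
      Finset.card_range, ← Finset.prod_mul_distrib, Fin.prod_univ_eq_prod_range
      (fun i => q ^ (r + d + 1) - q ^ i), Nat.cast_prod, ← Finset.prod_range_reflect]
    refine Finset.prod_congr rfl fun j hj => ?_
    have hj' := Finset.mem_range.1 hj
    rw [Nat.cast_sub (Nat.pow_le_pow_right (by exact_mod_cast hq0) (by omega))]
    have : (q : ℝ) ^ (r + d + 1) = q ^ (d + j + 2) * q ^ (r - 1 - j) := by
      rw [← pow_add]; congr 1; omega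
    push_cast
    rw [this]
    field_simp
  rw [hcast]
  push_cast
  refine mul_le_mul_of_nonneg_right ?_ (by positivity)
  rw [add_comm r d, Finset.prod_range_add]
  refine mul_le_of_le_one_left (Finset.prod_nonneg fun i _ => (hfac _).1) ?_
  exact Finset.prod_le_one (fun i _ => (hfac i).1) fun i _ => (hfac i).2

end FiniteField

section FiniteAbelianGroup

variable {G : Type*} [AddCommGroup G]

lemma span_int_eq_top_iff_span_zmod {p : ℕ} [Module (ZMod p) G] (s : Set G) :
    Submodule.span ℤ s = ⊤ ↔ Submodule.span (ZMod p) s = ⊤ := by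
  constructor
  · intro h
    rw [eq_top_iff]
    intro x _
    have hle : Submodule.span ℤ s ≤ AddSubgroup.toIntSubmodule
        (Submodule.span (ZMod p) s).toAddSubgroup :=
      Submodule.span_le.2 fun y hy => Submodule.subset_span (R := ZMod p) hy
    exact hle (h ▸ Submodule.mem_top : x ∈ Submodule.span ℤ s)
  · intro h
    rw [eq_top_iff]
    intro x _
    have hle : Submodule.span (ZMod p) s ≤ AddSubgroup.toZModSubmodule p
        (Submodule.span ℤ s).toAddSubgroup :=
      Submodule.span_le.2 fun y hy => Submodule.subset_span (R := ℤ) hy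
    exact hle (h ▸ Submodule.mem_top : x ∈ Submodule.span (ZMod p) s)

/-- The submodule `p G` of an abelian group `G`. -/
def nsmulRange (G : Type*) [AddCommGroup G] (p : ℕ) : Submodule ℤ G :=
  LinearMap.range (LinearMap.lsmul ℤ G (p : ℤ))

lemma zsmul_mem_nsmulRange {p : ℕ} {a : ℤ} (h : (p : ℤ) ∣ a) (x : G) :
    a • x ∈ nsmulRange G p := by
  obtain ⟨c, rfl⟩ := h
  exact ⟨c • x, by simp [mul_smul, smul_comm c]⟩

/-- Chinese remainder theorem for the quotients `G / p G`. -/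
lemma pi_mkQ_nsmulRange_surjective (s : Finset ℕ) (hs : ∀ p ∈ s, p.Prime) :
    Function.Surjective fun (x : G) (p : s) => (nsmulRange G p).mkQ x := by
  classical
  intro v
  choose g hg using fun p : s => (nsmulRange G p).mkQ_surjective (v p)
  have hco : ∀ p : s, IsCoprime (p : ℤ) (∏ q ∈ Finset.univ.erase p, (q : ℤ)) := by
    intro p
    refine IsCoprime.prod_right fun q hq => ?_
    refine Nat.isCoprime_iff_coprime.2 ((Nat.coprime_primes (hs p p.2) (hs q q.2)).2 ?_)
    exact fun h => (Finset.mem_erase.1 hq).1 (Subtype.ext h.symm)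
  choose a b hab using hco
  refine ⟨∑ p : s, (b p * ∏ q ∈ Finset.univ.erase p, (q : ℤ)) • g p, funext fun p => ?_⟩
  rw [← hg p]
  simp only
  rw [← sub_eq_zero, ← map_sub, Submodule.mkQ_apply, Submodule.Quotient.mk_eq_zero,
    ← Finset.add_sum_erase _ _ (Finset.mem_univ p), add_sub_right_comm]
  refine Submodule.add_mem _ ?_ (Submodule.sum_mem _ fun q hq => ?_)
  · have : (b p * ∏ q ∈ Finset.univ.erase p, (q : ℤ)) • g p - g p = (-(a p * p)) • g p := by
      rw [show -(a p * p) = b p * (∏ q ∈ Finset.univ.erase p, (q : ℤ)) - 1 by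
        linarith [hab p], sub_smul, one_smul]
    rw [this]
    exact zsmul_mem_nsmulRange ⟨-a p, by ring⟩ _
  · refine zsmul_mem_nsmulRange (Dvd.dvd.mul_left
      (Finset.dvd_prod_of_mem (fun q : s => (q : ℤ)) ?_) _) _
    exact Finset.mem_erase.2 ⟨(Finset.mem_erase.1 hq).1.symm, Finset.mem_univ _⟩

lemma span_range_mkQ_comp {ι : Type*} (N : Submodule ℤ G) (z : ι → G) :
    Submodule.span ℤ (Set.range fun i => N.mkQ (z i)) =
      (Submodule.span ℤ (Set.range z)).map N.mkQ := by
  rw [← Submodule.span_image, ← Set.range_comp]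
  rfl

lemma eq_top_of_forall_sup_nsmulRange_eq_top [Finite G] (H : Submodule ℤ G)
    (h : ∀ p ∈ (Nat.card G).primeFactors, nsmulRange G p ⊔ H = ⊤) : H = ⊤ := by
  by_contra hH
  have : Finite (G ⧸ H) := Finite.of_surjective _ H.mkQ_surjective
  have hcard : Nat.card (G ⧸ H) ≠ 1 := fun hc => by
    have : Subsingleton (G ⧸ H) := (Nat.card_eq_one_iff_unique.1 hc).1
    exact hH (Submodule.Quotient.subsingleton_iff.1 this)
  obtain ⟨p, hp, hdvd⟩ := Nat.exists_prime_and_dvd hcard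
  have : Fact p.Prime := ⟨hp⟩
  have hdvd' : p ∣ Nat.card G := hdvd.trans (H.toAddSubgroup.card_quotient_dvd_card)
  have hsup := h p (Nat.mem_primeFactors.2 ⟨hp, hdvd', Nat.card_pos.ne'⟩)
  have hsurj : Function.Surjective fun x : G ⧸ H => p • x := by
    intro x
    obtain ⟨x, rfl⟩ := H.mkQ_surjective x
    obtain ⟨_, ⟨y, rfl⟩, w, hw, hyw⟩ := Submodule.mem_sup.1 (hsup ▸ Submodule.mem_top : x ∈ _)
    refine ⟨H.mkQ y, ?_⟩
    rw [← hyw, map_add, (show H.mkQ w = 0 by simpa using hw)]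
    simp
  obtain ⟨x, hx⟩ := exists_prime_addOrderOf_dvd_card' p hdvd
  have hinj := Finite.injective_iff_surjective.2 hsurj
  have hx0 : x = 0 := hinj (by simp [← hx, addOrderOf_nsmul_eq_zero])
  rw [hx0, addOrderOf_zero] at hx
  exact hp.one_lt.ne hx

lemma span_eq_top_iff_forall_primeFactors [Finite G] {ι : Type*} (z : ι → G) :
    Submodule.span ℤ (Set.range z) = ⊤ ↔ ∀ p : (Nat.card G).primeFactors,
      Submodule.span ℤ (Set.range fun i => (nsmulRange G p).mkQ (z i)) = ⊤ := by
  simp only [span_range_mkQ_comp, Submodule.map_mkQ_eq_top]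
  constructor
  · intro h p
    rw [h, sup_top_eq]
  · exact fun h => eq_top_of_forall_sup_nsmulRange_eq_top _ fun p hp => h ⟨p, hp⟩

lemma card_preimage_mul_card {A C : Type*} [AddGroup A] [AddGroup C] [Finite A] [Finite C]
    (f : A →+ C) (hf : Function.Surjective f) (T : Set C) :
    Nat.card (f ⁻¹' T) * Nat.card C = Nat.card T * Nat.card A := by
  have hA : Nat.card A = Nat.card C * Nat.card f.ker := by
    rw [f.ker.card_eq_card_quotient_mul_card_addSubgroup,
      Nat.card_congr (QuotientAddGroup.quotientKerEquivOfSurjective f hf).toEquiv]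
  have hT : Nat.card (f ⁻¹' T) = Nat.card T * Nat.card f.ker := by
    rw [← Nat.card_prod]
    refine Nat.card_congr (Equiv.symm ?_)
    exact
      { toFun := fun x => ⟨Function.surjInv hf x.1 + x.2, by
          simp [Function.surjInv_eq hf, AddMonoidHom.mem_ker.1 x.2.2]⟩
        invFun := fun a => ⟨⟨f a, a.2⟩, ⟨-Function.surjInv hf (f a) + a, by
          simp [AddMonoidHom.mem_ker, Function.surjInv_eq hf]⟩⟩
        left_inv := fun x => by
          ext <;> simp [Function.surjInv_eq hf, AddMonoidHom.mem_ker.1 x.2.2]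
        right_inv := fun a => by ext; simp }
  rw [hT, hA]
  ring

lemma le_card_generating_tuples_of_nsmul_eq_zero [Finite G] {n p : ℕ} (hp : p.Prime)
    (hG : ∀ x : G, p • x = 0) (g : Fin n → G) (hg : Submodule.span ℤ (Set.range g) = ⊤) :
    (∏ i ∈ Finset.range n, (1 - ((p : ℝ) ^ (i + 2))⁻¹)) * (Nat.card G : ℝ) ^ (n + 1) ≤
      Nat.card {z : Fin (n + 1) → G // Submodule.span ℤ (Set.range z) = ⊤} := by
  have : Fact p.Prime := ⟨hp⟩
  let _ : Module (ZMod p) G := AddCommGroup.zmodModule hG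
  have hrank : Module.finrank (ZMod p) G ≤ n := by
    have := finrank_range_le_card (R := ZMod p) g
    rwa [Set.finrank, (span_int_eq_top_iff_span_zmod _).1 hg, finrank_top,
      Fintype.card_fin] at this
  have h := le_card_spanning_tuples (K := ZMod p) hrank
  rw [ZMod.card] at h
  simpa only [← span_int_eq_top_iff_span_zmod (p := p)] using h

lemma le_card_generating_tuples_nsmulRange [Finite G] {n p : ℕ} (hp : p.Prime) (g : Fin n → G)
    (hg : Submodule.span ℤ (Set.range g) = ⊤) :
    (∏ i ∈ Finset.range n, (1 - ((p : ℝ) ^ (i + 2))⁻¹)) *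
      (Nat.card (G ⧸ nsmulRange G p) : ℝ) ^ (n + 1) ≤
      Nat.card {z : Fin (n + 1) → G ⧸ nsmulRange G p //
        Submodule.span ℤ (Set.range z) = ⊤} := by
  have : Finite (G ⧸ nsmulRange G p) := Finite.of_surjective _ (nsmulRange G p).mkQ_surjective
  refine le_card_generating_tuples_of_nsmul_eq_zero hp (fun x => ?_)
    (fun i => (nsmulRange G p).mkQ (g i)) ?_
  · obtain ⟨x, rfl⟩ := (nsmulRange G p).mkQ_surjective x
    rw [← map_nsmul, Submodule.mkQ_apply, Submodule.Quotient.mk_eq_zero, ← natCast_zsmul]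
    exact zsmul_mem_nsmulRange dvd_rfl x
  · rw [span_range_mkQ_comp, hg, Submodule.map_top, Submodule.range_mkQ]

/-- In a finite abelian group generated by `n` elements, the proportion of generating
`(n + 1)`-tuples is at least `∏_{i ≥ 2} ζ(i)⁻¹`. -/
theorem le_card_generating_tuples [Finite G] {n : ℕ} (g : Fin n → G)
    (hg : Submodule.span ℤ (Set.range g) = ⊤) :
    (∏' i : ℕ, (zetaR (i + 2))⁻¹) * (Nat.card G : ℝ) ^ (n + 1) ≤
      Nat.card {z : Fin (n + 1) → G // Submodule.span ℤ (Set.range z) = ⊤} := by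
  set s := (Nat.card G).primeFactors with hs
  have hprime : ∀ p ∈ s, p.Prime := fun p hp => Nat.prime_of_mem_primeFactors hp
  let V : s → Type _ := fun p => G ⧸ nsmulRange G p
  have hV : ∀ p, Finite (V p) := fun p => Finite.of_surjective _ (nsmulRange G p).mkQ_surjective
  let f : (Fin (n + 1) → G) →+ (∀ p : s, Fin (n + 1) → V p) :=
    { toFun := fun z p i => (nsmulRange G p).mkQ (z i)
      map_zero' := by ext; simp
      map_add' := fun _ _ => by ext; simp }
  have hf : Function.Surjective f := by
    intro w
    choose z hz using fun i => pi_mkQ_nsmulRange_surjective s hprime fun p => w p i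
    exact ⟨z, funext fun p => funext fun i => congrFun (hz i) p⟩
  have hcard := card_preimage_mul_card f hf
    {w | ∀ p, Submodule.span ℤ (Set.range (w p)) = ⊤}
  have hpre : Nat.card {z : Fin (n + 1) → G // Submodule.span ℤ (Set.range z) = ⊤} =
      Nat.card (f ⁻¹' {w | ∀ p, Submodule.span ℤ (Set.range (w p)) = ⊤}) :=
    Nat.card_congr (Equiv.subtypeEquivRight fun z => span_eq_top_iff_forall_primeFactors z)
  have hT : Nat.card {w : ∀ p : s, Fin (n + 1) → V p |
      ∀ p, Submodule.span ℤ (Set.range (w p)) = ⊤} =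
      ∏ p : s, Nat.card {z : Fin (n + 1) → V p // Submodule.span ℤ (Set.range z) = ⊤} := by
    rw [← Nat.card_pi]
    exact Nat.card_congr (Equiv.subtypePiEquivPi
      (p := fun (p : s) (z : Fin (n + 1) → V p) => Submodule.span ℤ (Set.range z) = ⊤))
  have hC : Nat.card (∀ p : s, Fin (n + 1) → V p) = ∏ p : s, Nat.card (V p) ^ (n + 1) := by
    rw [Nat.card_pi]
    exact Finset.prod_congr rfl fun p _ => by rw [Nat.card_fun, Nat.card_fin]
  have hA : Nat.card (Fin (n + 1) → G) = Nat.card G ^ (n + 1) := by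
    rw [Nat.card_fun, Nat.card_fin]
  rw [hpre]
  rw [hT, hC, hA] at hcard
  have hVpos : ∀ p : s, 0 < (Nat.card (V p) : ℝ) := fun p => by
    have : Nonempty (V p) := ⟨(0 : G ⧸ nsmulRange G p)⟩
    exact_mod_cast Nat.card_pos
  have hCpos : 0 < ∏ p : s, (Nat.card (V p) : ℝ) ^ (n + 1) :=
    Finset.prod_pos fun p _ => pow_pos (hVpos p) _
  refine le_of_mul_le_mul_right ?_ hCpos
  have hcard' := congrArg (Nat.cast : ℕ → ℝ) hcard
  push_cast at hcard'
  rw [hcard', mul_right_comm]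
  refine mul_le_mul_of_nonneg_right ?_ (by positivity)
  have hnn : ∀ (p : s) (i : ℕ), 0 ≤ 1 - ((p : ℝ) ^ (i + 2))⁻¹ := fun p i =>
    sub_nonneg.2 (inv_le_one_of_one_le₀
      (one_le_pow₀ (by exact_mod_cast (hprime p p.2).one_lt.le)))
  have hzeta : ∏' i : ℕ, (zetaR (i + 2))⁻¹ ≤
      ∏ p : s, ∏ i ∈ Finset.range n, (1 - ((p : ℝ) ^ (i + 2))⁻¹) := by
    rw [Finset.prod_comm]
    refine (tprod_inv_zetaR_le_prod n).trans (Finset.prod_le_prod (fun i _ => ?_) fun i _ => ?_)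
    · exact inv_nonneg.2 (zero_le_one.trans (one_le_zetaR (by omega)))
    · rw [Finset.prod_coe_sort s fun p : ℕ => 1 - ((p : ℝ) ^ (i + 2))⁻¹]
      exact inv_zetaR_le_prod_primes (by omega) s hprime
  calc _ ≤ (∏ p : s, ∏ i ∈ Finset.range n, (1 - ((p : ℝ) ^ (i + 2))⁻¹)) *
        ∏ p : s, (Nat.card (V p) : ℝ) ^ (n + 1) := mul_le_mul_of_nonneg_right hzeta hCpos.le
    _ ≤ _ := by
        rw [← Finset.prod_mul_distrib]
        refine Finset.prod_le_prod (fun p _ => mul_nonneg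
          (Finset.prod_nonneg fun i _ => hnn p i) (pow_pos (hVpos p) _).le) fun p _ => ?_
        exact le_card_generating_tuples_nsmulRange (hprime p p.2) g hg

end FiniteAbelianGroup

section LatticePointCount

open MeasureTheory ZSpan
open scoped Pointwise

variable {n : ℕ}

/-- The half-open cube `[lo, hi)^n`. -/
def box (n : ℕ) (lo hi : ℝ) : Set (EuclideanSpace ℝ (Fin n)) :=
  {x | ∀ i, lo ≤ x i ∧ x i < hi}

lemma volume_box (lo hi : ℝ) : volume (box n lo hi) = ENNReal.ofReal (hi - lo) ^ n := by
  have h : box n lo hi = (WithLp.ofLp : EuclideanSpace ℝ (Fin n) → Fin n → ℝ) ⁻¹'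
      Set.univ.pi fun _ => Set.Ico lo hi := by
    ext x; simp [box]
  rw [h, (PiLp.volume_preserving_ofLp (Fin n)).measure_preimage
    (MeasurableSet.univ_pi fun _ => measurableSet_Ico).nullMeasurableSet, Real.volume_pi_Ico]
  simp

variable (b : Module.Basis (Fin n) ℝ (EuclideanSpace ℝ (Fin n))) {B : ℝ}

lemma coord_mem_Icc_of_mem_fundamentalDomain (hb : ∀ i, b i ∈ cube n B)
    {f : EuclideanSpace ℝ (Fin n)} (hf : f ∈ fundamentalDomain b) (i : Fin n) :
    f i ∈ Set.Icc 0 (n * B) := by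
  have h : f i = ∑ j, b.repr f j * b j i := by
    have h := congrArg (fun x : EuclideanSpace ℝ (Fin n) => x i) (b.sum_repr f)
    simpa [-Module.Basis.sum_repr] using h.symm
  have hr := fun j => (mem_fundamentalDomain b).1 hf j
  rw [h]
  refine ⟨Finset.sum_nonneg fun j _ => mul_nonneg (hr j).1 (hb j i).1, ?_⟩
  calc _ ≤ ∑ j : Fin n, B := Finset.sum_le_sum fun j _ =>
        (mul_le_of_le_one_left (hb j i).1 (hr j).2.le).trans (hb j i).2.le
    _ = _ := by simp

/-- The points of the coset of `a` modulo the lattice spanned by `b` lying in `[0, R)^n`. -/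
def cosetPoints (a : EuclideanSpace ℝ (Fin n)) (R : ℝ) : Set (EuclideanSpace ℝ (Fin n)) :=
  {v ∈ cube n R | v - a ∈ Submodule.span ℤ (Set.range b)}

lemma volume_iUnion_vadd_fundamentalDomain (a : EuclideanSpace ℝ (Fin n)) {R : ℝ}
    (hfin : (cosetPoints b a R).Finite) :
    volume (⋃ v ∈ cosetPoints b a R, v +ᵥ fundamentalDomain b) =
      (cosetPoints b a R).ncard * volume (fundamentalDomain b) := by
  rw [measure_biUnion hfin.countable]
  · simp_rw [measure_vadd]
    rw [ENNReal.tsum_const]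
    simp [← hfin.cast_ncard_eq]
  · intro v hv w hw hvw
    refine Set.disjoint_left.2 ?_
    rintro _ ⟨f, hf, rfl⟩ ⟨f', hf', h⟩
    apply hvw
    simp only [vadd_eq_add] at h
    have hmem : v - w ∈ Submodule.span ℤ (Set.range b) := by
      simpa using sub_mem hv.2 hw.2
    have hff : f' = f + (v - w) := by rw [← sub_eq_zero] at h ⊢; rw [← h]; abel
    have h1 := fract_add_ZSpan b f hmem
    rw [← hff, (fract_eq_self (b := b)).2 hf', (fract_eq_self (b := b)).2 hf] at h1
    rw [h1] at h
    exact (add_right_cancel h).symm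
  · exact fun v _ => (fundamentalDomain_measurableSet b).const_vadd v

lemma le_ncard_cosetPoints_mul_volume (hb : ∀ i, b i ∈ cube n B) (a : EuclideanSpace ℝ (Fin n))
    {R : ℝ} (hfin : (cosetPoints b a R).Finite) :
    ENNReal.ofReal (R - n * B) ^ n ≤
      (cosetPoints b a R).ncard * volume (fundamentalDomain b) := by
  rw [← volume_iUnion_vadd_fundamentalDomain b a hfin, ← volume_box]
  refine measure_mono fun x hx => ?_
  have hf := fract_mem_fundamentalDomain b (x - a)
  refine Set.mem_biUnion (x := x - fract b (x - a)) ⟨fun i => ?_, ?_⟩ ⟨_, hf, by simp⟩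
  · have h1 := coord_mem_Icc_of_mem_fundamentalDomain b hb hf i
    have h2 := hx i
    simp only [PiLp.sub_apply]
    constructor <;> linarith [h1.1, h1.2]
  · rw [fract_apply, show x - (x - a - floor b (x - a)) - a = floor b (x - a) by abel]
    exact (floor b (x - a)).2

lemma ncard_cosetPoints_mul_volume_le (hb : ∀ i, b i ∈ cube n B) (a : EuclideanSpace ℝ (Fin n))
    {R : ℝ} (hfin : (cosetPoints b a R).Finite) :
    (cosetPoints b a R).ncard * volume (fundamentalDomain b) ≤
      ENNReal.ofReal (R + n * B) ^ n := by
  rw [← volume_iUnion_vadd_fundamentalDomain b a hfin, ← sub_zero (R + n * B), ← volume_box]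
  refine measure_mono (Set.iUnion₂_subset fun v hv => ?_)
  rintro _ ⟨f, hf, rfl⟩ i
  have h1 := coord_mem_Icc_of_mem_fundamentalDomain b hb hf i
  have h2 := hv.1 i
  simp only [vadd_eq_add, PiLp.add_apply]
  constructor <;> linarith [h1.1, h1.2]

lemma one_sub_mul_pow_le {R : ℝ} (hn : 1 ≤ n) (hB : 0 < B)
    (hR : R ≥ 8 * (n : ℝ) ^ 2 * ((n : ℝ) + 1) * B) :
    (1 - 1 / (4 * ((n : ℝ) + 1))) * (R + n * B) ^ n ≤ (R - n * B) ^ n := by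
  have hn' : (1 : ℝ) ≤ n := by exact_mod_cast hn
  have hpos : 0 < R + n * B := by
    have : 0 ≤ 8 * (n : ℝ) ^ 2 * ((n : ℝ) + 1) * B := by positivity
    have : 0 < n * B := by positivity
    linarith
  have hnB : 0 < n * B := by positivity
  set t := 2 * (n * B) / (R + n * B) with ht
  have htle : n * t ≤ 1 / (4 * ((n : ℝ) + 1)) := by
    rw [ht, ← mul_div_assoc, div_le_div_iff₀ hpos (by positivity)]
    nlinarith
  have ht2 : t ≤ 2 := by
    rw [ht, div_le_iff₀ hpos]
    have : 0 ≤ 8 * (n : ℝ) ^ 2 * ((n : ℝ) + 1) * B := by positivity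
    linarith
  have hbern := one_add_mul_le_pow (a := -t) (by linarith) n
  have heq : R - n * B = (1 + -t) * (R + n * B) := by
    rw [ht]; field_simp; ring
  rw [heq, mul_pow]
  exact mul_le_mul_of_nonneg_right (by linarith) (by positivity)

/-- The cosets of a sublattice with a short basis are almost equidistributed in a large cube. -/
lemma ncard_cosetPoints_le {R : ℝ} (hn : 1 ≤ n) (hB : 0 < B)
    (hR : R ≥ 8 * (n : ℝ) ^ 2 * ((n : ℝ) + 1) * B) (hb : ∀ i, b i ∈ cube n B)
    (a a' : EuclideanSpace ℝ (Fin n)) (ha : (cosetPoints b a R).Finite)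
    (ha' : (cosetPoints b a' R).Finite) :
    (1 - 1 / (4 * ((n : ℝ) + 1))) * (cosetPoints b a R).ncard ≤ (cosetPoints b a' R).ncard := by
  have hn' : (1 : ℝ) ≤ n := by exact_mod_cast hn
  have hR1 : n * B ≤ R := by
    refine le_trans ?_ hR
    refine mul_le_mul_of_nonneg_right ?_ hB.le
    nlinarith
  have hnB : 0 < n * B := by positivity
  have hfin : volume (fundamentalDomain b) ≠ ⊤ :=
    (fundamentalDomain_isBounded b).measure_lt_top.ne
  have hV : 0 < (volume (fundamentalDomain b)).toReal :=
    ENNReal.toReal_pos (measure_fundamentalDomain_ne_zero b) hfin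
  have h1 := ENNReal.toReal_mono (by finiteness) (ncard_cosetPoints_mul_volume_le b hb a ha)
  have h2 := ENNReal.toReal_mono (by finiteness) (le_ncard_cosetPoints_mul_volume b hb a' ha')
  rw [ENNReal.toReal_mul, ENNReal.toReal_pow, ENNReal.toReal_ofReal (by linarith),
    ENNReal.toReal_natCast] at h1 h2
  refine le_of_mul_le_mul_right ?_ hV
  have hδ : 0 ≤ 1 - 1 / (4 * ((n : ℝ) + 1)) := by
    rw [sub_nonneg, div_le_one (by positivity)]
    linarith
  calc _ = (1 - 1 / (4 * ((n : ℝ) + 1))) * ((cosetPoints b a R).ncard *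
        (volume (fundamentalDomain b)).toReal) := by ring
    _ ≤ (1 - 1 / (4 * ((n : ℝ) + 1))) * (R + n * B) ^ n := mul_le_mul_of_nonneg_left h1 hδ
    _ ≤ (R - n * B) ^ n := one_sub_mul_pow_le hn hB hR
    _ ≤ _ := h2

end LatticePointCount

section Quotient

variable {n : ℕ} (Λ : Submodule ℤ (EuclideanSpace ℝ (Fin n)))

lemma finite_inter_of_isBounded [DiscreteTopology Λ] {s : Set (EuclideanSpace ℝ (Fin n))}
    (hs : Bornology.IsBounded s) : ((Λ : Set (EuclideanSpace ℝ (Fin n))) ∩ s).Finite := by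
  rw [Set.inter_comm]
  refine Metric.finite_isBounded_inter_isClosed
    (SetLike.isDiscrete_iff_discreteTopology.2 inferInstance) hs ?_
  rw [← Submodule.coe_toAddSubgroup]
  have : DiscreteTopology Λ.toAddSubgroup := ‹DiscreteTopology Λ›
  exact AddSubgroup.isClosed_of_discrete

lemma isBounded_cube (R : ℝ) : Bornology.IsBounded (cube n R) := by
  refine (isBounded_iff_forall_norm_le).2 ⟨√(∑ _i : Fin n, R ^ 2), fun x hx => ?_⟩
  rw [EuclideanSpace.norm_eq]
  refine Real.sqrt_le_sqrt (Finset.sum_le_sum fun i _ => ?_)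
  rw [Real.norm_eq_abs, sq_abs]
  exact pow_le_pow_left₀ (hx i).1 (hx i).2.le 2

/-- The sublattice spanned by `y`, as a submodule of `Λ`. -/
def sublattice (y : Fin n → EuclideanSpace ℝ (Fin n)) : Submodule ℤ Λ :=
  (Submodule.span ℤ (Set.range y)).comap Λ.subtype

lemma mkQ_sublattice_eq_iff {y : Fin n → EuclideanSpace ℝ (Fin n)} (v w : Λ) :
    (sublattice Λ y).mkQ v = (sublattice Λ y).mkQ w ↔
      (v : EuclideanSpace ℝ (Fin n)) - w ∈ Submodule.span ℤ (Set.range y) := by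
  rw [← sub_eq_zero, ← map_sub, Submodule.mkQ_apply, Submodule.Quotient.mk_eq_zero]
  rfl

variable {Λ}

lemma finite_quotient_sublattice [DiscreteTopology Λ]
    (b : Module.Basis (Fin n) ℝ (EuclideanSpace ℝ (Fin n))) (hb : ∀ i, b i ∈ Λ) :
    Finite (Λ ⧸ sublattice Λ b) := by
  have hspan : Submodule.span ℤ (Set.range b) ≤ Λ :=
    Submodule.span_le.2 (Set.range_subset_iff.2 hb)
  have hfin : Finite ((Λ : Set (EuclideanSpace ℝ (Fin n))) ∩ ZSpan.fundamentalDomain b : Set _) :=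
    finite_inter_of_isBounded Λ (ZSpan.fundamentalDomain_isBounded b)
  refine Finite.of_surjective (fun v : ((Λ : Set (EuclideanSpace ℝ (Fin n))) ∩
    ZSpan.fundamentalDomain b : Set _) => (sublattice Λ b).mkQ ⟨v, v.2.1⟩) fun x => ?_
  obtain ⟨x, rfl⟩ := (sublattice Λ b).mkQ_surjective x
  refine ⟨⟨ZSpan.fract b x, Λ.sub_mem x.2 (hspan (ZSpan.floor b x).2),
    ZSpan.fract_mem_fundamentalDomain b _⟩, ?_⟩
  rw [mkQ_sublattice_eq_iff]
  simp only [ZSpan.fract_apply, sub_sub_cancel_left]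
  exact neg_mem (ZSpan.floor b x).2

lemma span_union_eq_of_span_mkQ_eq_top {ι : Type*} {y : Fin n → EuclideanSpace ℝ (Fin n)}
    (hy : ∀ i, y i ∈ Λ) (z : ι → Λ)
    (hz : Submodule.span ℤ (Set.range fun i => (sublattice Λ y).mkQ (z i)) = ⊤) :
    Submodule.span ℤ (Set.range y ∪ Set.range fun i => (z i : EuclideanSpace ℝ (Fin n))) = Λ := by
  apply le_antisymm
  · refine Submodule.span_le.2 (Set.union_subset ?_ ?_)
    · exact Set.range_subset_iff.2 hy
    · exact Set.range_subset_iff.2 fun i => (z i).2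
  · intro x hx
    have hmem : (sublattice Λ y).mkQ ⟨x, hx⟩ ∈
        (Submodule.span ℤ (Set.range z)).map (sublattice Λ y).mkQ := by
      rw [← span_range_mkQ_comp, hz]
      exact Submodule.mem_top
    obtain ⟨u, hu, hux⟩ := hmem
    rw [eq_comm, mkQ_sublattice_eq_iff] at hux
    have hu' : (u : EuclideanSpace ℝ (Fin n)) ∈
        Submodule.span ℤ (Set.range fun i => (z i : EuclideanSpace ℝ (Fin n))) := by
      have h := Submodule.mem_map_of_mem (f := Λ.subtype) hu
      rwa [← Submodule.span_image, ← Set.range_comp] at h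
    rw [Submodule.span_union, ← sub_add_cancel x (u : EuclideanSpace ℝ (Fin n))]
    exact Submodule.add_mem_sup hux hu'

lemma exists_generators_quotient [DiscreteTopology Λ] [IsZLattice ℝ Λ] (N : Submodule ℤ Λ) :
    ∃ g : Fin n → Λ ⧸ N, Submodule.span ℤ (Set.range g) = ⊤ := by
  have : Module.Free ℤ Λ := ZLattice.module_free ℝ Λ
  have : Module.Finite ℤ Λ := ZLattice.module_finite ℝ Λ
  have hrank : Module.finrank ℤ Λ = n := by rw [ZLattice.rank ℝ Λ, finrank_euclideanSpace_fin]
  let c := Module.finBasisOfFinrankEq ℤ Λ hrank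
  refine ⟨fun i => N.mkQ (c i), ?_⟩
  rw [span_range_mkQ_comp, c.span_eq, Submodule.map_top, Submodule.range_mkQ]

end Quotient

/-- If the fibres of a map `X → G` all have at least `m` elements, then a set `S` of tuples in `G`
lifts to at least `|S| m ^ k` tuples in `X`. -/
lemma card_mul_pow_le_card_preimage {X G : Type*} [Finite X] [Finite G] {m k : ℕ} (π : X → G)
    (h : ∀ g, m ≤ Nat.card {x // π x = g}) (S : Set (Fin k → G)) :
    Nat.card S * m ^ k ≤ Nat.card {z : Fin k → X // π ∘ z ∈ S} := by
  have hex : ∀ g, Nonempty (Fin m ↪ {x // π x = g}) := fun g => by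
    have := Fintype.ofFinite {x // π x = g}
    refine Function.Embedding.nonempty_of_card_le ?_
    simpa [Nat.card_eq_fintype_card] using h g
  let e : ∀ g, Fin m ↪ {x // π x = g} := fun g => (hex g).some
  have hcard : Nat.card (S × (Fin k → Fin m)) = Nat.card S * m ^ k := by
    rw [Nat.card_prod, Nat.card_fun, Nat.card_fin, Nat.card_fin]
  rw [← hcard]
  have hπ : ∀ (z : Fin k → G) (w : Fin k → Fin m), (π ∘ fun i => ((e (z i) (w i) : X))) = z :=
    fun z w => funext fun i => (e (z i) (w i)).2
  refine Nat.card_le_card_of_injective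
    (fun x : S × (Fin k → Fin m) =>
      (⟨fun i => e (x.1.1 i) (x.2 i), by rw [hπ]; exact x.1.2⟩ :
        {z : Fin k → X // π ∘ z ∈ S})) ?_
  rintro ⟨⟨z, hz⟩, w⟩ ⟨⟨z', hz'⟩, w'⟩ heq
  have h1 := congrArg Subtype.val heq
  simp only at h1
  have hzz : z = z' := by rw [← hπ z w, h1, hπ]
  subst hzz
  have hww : w = w' := funext fun i => (e (z i)).injective (Subtype.ext (congrFun h1 i))
  rw [hww]

theorem generate_whole_lattice (n : ℕ) (hn : 1 ≤ n)
    (Λ : Submodule ℤ (EuclideanSpace ℝ (Fin n)))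
    [DiscreteTopology Λ] [IsZLattice ℝ Λ] (B B₁ : ℝ)
    (hB : B ≥ 8 * (n : ℝ) ^ ((n : ℝ) / 2) * covRad Λ)
    (hB₁ : B₁ ≥ 8 * (n : ℝ) ^ 2 * ((n : ℝ) + 1) * B)
    (y : Fin n → EuclideanSpace ℝ (Fin n))
    (hy : ∀ i, y i ∈ (Λ : Set (EuclideanSpace ℝ (Fin n))) ∩ cube n B)
    (hspan : Submodule.span ℝ (Set.range y) = ⊤)
    (X₁ : Set (Fin (n + 1) → EuclideanSpace ℝ (Fin n)))
    (hX₁ : X₁ = {z | ∀ i, z i ∈ (Λ : Set (EuclideanSpace ℝ (Fin n))) ∩ cube n B₁})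
    (Z : Set (Fin (n + 1) → EuclideanSpace ℝ (Fin n)))
    (hZ : Z = {z ∈ X₁ | Submodule.span ℤ (Set.range y ∪ Set.range z) = Λ}) :
    (Z.ncard : ℝ) ≥ ((∏' i : ℕ, (zetaR (i + 2))⁻¹) - 1 / 4) * (X₁.ncard : ℝ) ∧
    ((∏' i : ℕ, (zetaR (i + 2))⁻¹) - 1 / 4) * (X₁.ncard : ℝ) ≥ 0.184 * (X₁.ncard : ℝ) := by
  have hP := le_tprod_inv_zetaR
  refine ⟨?_, mul_le_mul_of_nonneg_right (by linarith) (Nat.cast_nonneg _)⟩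
  have hP1 : ∏' i : ℕ, (zetaR (i + 2))⁻¹ ≤ 1 := by simpa using tprod_inv_zetaR_le_prod 0
  set P := ∏' i : ℕ, (zetaR (i + 2))⁻¹
  have hBpos : 0 < B := lt_of_le_of_lt ((hy ⟨0, hn⟩).2 ⟨0, hn⟩).1 ((hy ⟨0, hn⟩).2 ⟨0, hn⟩).2
  let b : Module.Basis (Fin n) ℝ (EuclideanSpace ℝ (Fin n)) :=
    basisOfTopLeSpanOfCardEqFinrank y hspan.ge (by simp)
  have hby : ⇑b = y := coe_basisOfTopLeSpanOfCardEqFinrank _ _ _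
  have hbΛ : ∀ i, b i ∈ Λ := fun i => by rw [hby]; exact (hy i).1
  have hbcube : ∀ i, b i ∈ cube n B := fun i => by rw [hby]; exact (hy i).2
  have hspanΛ : Submodule.span ℤ (Set.range b) ≤ Λ :=
    Submodule.span_le.2 (Set.range_subset_iff.2 hbΛ)
  let N := sublattice Λ b
  have hG : Finite (Λ ⧸ N) := finite_quotient_sublattice b hbΛ
  let X : Set (EuclideanSpace ℝ (Fin n)) := (Λ : Set (EuclideanSpace ℝ (Fin n))) ∩ cube n B₁
  have hXfin : X.Finite := finite_inter_of_isBounded Λ (isBounded_cube B₁)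
  have hX : Finite X := hXfin
  let π : X → Λ ⧸ N := fun x => N.mkQ ⟨x, x.2.1⟩
  have hcoset : ∀ a : Λ, cosetPoints b a B₁ ⊆ X := fun a v hv =>
    ⟨by simpa using Λ.add_mem (hspanΛ hv.2) a.2, hv.1⟩
  have hfibre : ∀ a : Λ, Nat.card {x // π x = N.mkQ a} = (cosetPoints b a B₁).ncard := fun a =>
    Nat.card_congr
      { toFun := fun x => ⟨x.1, x.1.2.2, (mkQ_sublattice_eq_iff Λ _ _).1 x.2⟩
        invFun := fun v => ⟨⟨v, hcoset a v.2⟩, (mkQ_sublattice_eq_iff Λ _ _).2 v.2.2⟩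
        left_inv := fun _ => rfl
        right_inv := fun _ => rfl }
  set δ : ℝ := 1 / (4 * ((n : ℝ) + 1)) with hδ
  have hequi : ∀ g g' : Λ ⧸ N,
      (1 - δ) * Nat.card {x // π x = g} ≤ Nat.card {x // π x = g'} := by
    intro g g'
    obtain ⟨a, rfl⟩ := N.mkQ_surjective g
    obtain ⟨a', rfl⟩ := N.mkQ_surjective g'
    rw [hfibre, hfibre]
    exact ncard_cosetPoints_le b hn hBpos hB₁ hbcube a a' (hXfin.subset (hcoset a))
      (hXfin.subset (hcoset a'))
  obtain ⟨g₀, hg₀⟩ := Finite.exists_min fun g : Λ ⧸ N => Nat.card {x // π x = g}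
  set m := Nat.card {x // π x = g₀}
  have hXle : (1 - δ) * Nat.card X ≤ Nat.card (Λ ⧸ N) * m := by
    have := Fintype.ofFinite (Λ ⧸ N)
    rw [← Nat.card_congr (Equiv.sigmaFiberEquiv π), Nat.card_sigma, Nat.cast_sum, Finset.mul_sum]
    refine (Finset.sum_le_sum fun g _ => hequi g g₀).trans_eq ?_
    simp [Nat.card_eq_fintype_card, m]
  obtain ⟨g, hg⟩ := exists_generators_quotient (Λ := Λ) N
  have hgen := le_card_generating_tuples g hg
  set S : Set (Fin (n + 1) → Λ ⧸ N) := {z | Submodule.span ℤ (Set.range z) = ⊤}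
  have hlift := card_mul_pow_le_card_preimage π hg₀ S
  have hX₁card : X₁.ncard = Nat.card X ^ (n + 1) := by
    have h : Nat.card (Fin (n + 1) → X) = Nat.card X ^ (n + 1) := by
      rw [Nat.card_fun, Nat.card_fin]
    rw [← h, hX₁]
    exact Nat.card_congr (Equiv.subtypePiEquivPi (p := fun (_ : Fin (n + 1)) v => v ∈ X))
  have hZle : Nat.card {z : Fin (n + 1) → X // π ∘ z ∈ S} ≤ Z.ncard := by
    have hX₁fin : X₁.Finite := by
      rw [hX₁]
      exact Set.Finite.pi' fun _ => hXfin
    have hZfin : Finite Z := hX₁fin.subset (by rw [hZ]; exact Set.sep_subset _ _)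
    have hmem : ∀ z : {z : Fin (n + 1) → X // π ∘ z ∈ S},
        (fun i => (z.1 i : EuclideanSpace ℝ (Fin n))) ∈ Z := by
      intro z
      rw [hZ, hX₁]
      refine ⟨fun i => (z.1 i).2, ?_⟩
      have h := span_union_eq_of_span_mkQ_eq_top hbΛ (fun i => ⟨z.1 i, (z.1 i).2.1⟩) z.2
      rwa [hby] at h
    refine Nat.card_le_card_of_injective (β := Z) (fun z => ⟨_, hmem z⟩) fun z z' h => ?_
    exact Subtype.ext (funext fun i => Subtype.ext (congrFun (congrArg Subtype.val h) i))
  have hn0 : (0 : ℝ) < (n : ℝ) + 1 := by positivity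
  have hδn : ((n + 1 : ℕ) : ℝ) * δ = 1 / 4 := by
    rw [hδ]; push_cast; field_simp
  have hδ1 : δ ≤ 1 / 4 := by
    rw [hδ]
    refine one_div_le_one_div_of_le (by norm_num) ?_
    have : (0 : ℝ) ≤ n := n.cast_nonneg
    linarith
  have hbern := one_add_mul_le_pow (a := -δ) (by linarith) (n + 1)
  have hδpow : 3 / 4 ≤ (1 - δ) ^ (n + 1) := by
    rw [sub_eq_add_neg]
    linarith
  rw [hX₁card]
  push_cast
  have hXnn : (0 : ℝ) ≤ (Nat.card X : ℝ) ^ (n + 1) := by positivity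
  calc (P - 1 / 4) * (Nat.card X : ℝ) ^ (n + 1)
      ≤ P * (1 - δ) ^ (n + 1) * (Nat.card X : ℝ) ^ (n + 1) := by
        refine mul_le_mul_of_nonneg_right ?_ hXnn
        nlinarith
    _ = P * ((1 - δ) * Nat.card X) ^ (n + 1) := by rw [mul_pow, mul_assoc]
    _ ≤ P * (Nat.card (Λ ⧸ N) * m) ^ (n + 1) := by
        refine mul_le_mul_of_nonneg_left (pow_le_pow_left₀ ?_ hXle _) (by linarith)
        exact mul_nonneg (by linarith) (Nat.cast_nonneg _)
    _ = P * (Nat.card (Λ ⧸ N)) ^ (n + 1) * (m : ℝ) ^ (n + 1) := by rw [mul_pow, mul_assoc]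
    _ ≤ Nat.card S * (m : ℝ) ^ (n + 1) := mul_le_mul_of_nonneg_right hgen (by positivity)
    _ ≤ Nat.card {z : Fin (n + 1) → X // π ∘ z ∈ S} := by exact_mod_cast hlift
    _ ≤ Z.ncard := by exact_mod_cast hZle
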